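/- arXiv:2302.13414 — 4 statements merged into one kernel-verified Lean document; each statement's English description precedes it below -/
import Mathlib

section
/- If p is a feasible deviation vector, Δ := min_{s∈S} w(s)·p(s) and δ := max_{s∈S} w(s)·p(s) − Δ, then for every F ∈ 𝓕 one has (c − p^{δ,Δ}_{ℓ,u,w})(F*) − (c − p^{δ,Δ}_{ℓ,u,w})(F) ≤ (c − p)(F*) − (c − p)(F) ≤ 0; in particular p^{δ,Δ}_{ℓ,u,w} is a feasible deviation vector and spa_w(p^{δ,Δ}_{ℓ,u,w}) ≤ δ = spa_w(p). -/
open Finset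

noncomputable section

variable {S : Type*}

/-- Sum of a real-valued function over a finite subset: `f(X) = ∑_{s∈X} f(s)`. -/
def costSum (c : S → ℝ) (X : Finset S) : ℝ := ∑ s ∈ X, c s

/-- The weighted span `spa_w(p) = max_{s∈S} w(s)p(s) − min_{s∈S} w(s)p(s)`. -/
def spa [Fintype S] [Nonempty S] (w p : S → ℝ) : ℝ :=
  (univ.sup' univ_nonempty fun s => w s * p s) -
    (univ.inf' univ_nonempty fun s => w s * p s)

/-- A deviation vector `p` is feasible if `F*` has minimum `(c−p)`-cost in `𝓕`
and `ℓ ≤ p ≤ u` pointwise. -/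
def IsFeasible (𝓕 : Finset (Finset S)) (Fstar : Finset S) (c : S → ℝ)
    (ℓ u : S → EReal) (p : S → ℝ) : Prop :=
  (∀ F ∈ 𝓕, costSum (fun s => c s - p s) Fstar ≤ costSum (fun s => c s - p s) F) ∧
    (∀ s, ℓ s ≤ (p s : EReal)) ∧ (∀ s, (p s : EReal) ≤ u s)

/-- The special deviation vector `p^{δ,Δ}_{ℓ,u,w}`: the value `(δ+Δ)/w(s)` on `F*`
and `Δ/w(s)` outside `F*`, truncated to `[ℓ(s), u(s)]`. -/
def pdd [DecidableEq S] (Fstar : Finset S) (w : S → ℝ) (ℓ u : S → EReal)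
    (δ Δ : ℝ) (s : S) : ℝ :=
  let v : ℝ := if s ∈ Fstar then (δ + Δ) / w s else Δ / w s
  if (v : EReal) < ℓ s then (ℓ s).toReal
  else if (u s : EReal) < (v : EReal) then (u s).toReal
  else v

/-- As an extended real, `pdd` is the truncation of its defining value to `[ℓ s, u s]`. -/
theorem coe_pdd [DecidableEq S] (Fstar : Finset S) (w : S → ℝ) (ℓ u : S → EReal) (δ Δ : ℝ)
    {s : S} (hl : ℓ s ≠ ⊤) (hu : u s ≠ ⊥) (hlu : ℓ s ≤ u s) :
    (pdd Fstar w ℓ u δ Δ s : EReal) =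
      max (ℓ s) (min (u s) ((if s ∈ Fstar then (δ + Δ) / w s else Δ / w s : ℝ) : EReal)) := by
  unfold pdd
  generalize (if s ∈ Fstar then (δ + Δ) / w s else Δ / w s : ℝ) = v
  dsimp only
  split_ifs with h₁ h₂
  · rw [EReal.coe_toReal hl (ne_bot_of_gt h₁), min_eq_right (h₁.le.trans hlu),
      max_eq_left h₁.le]
  · rw [EReal.coe_toReal (ne_top_of_lt h₂) hu, min_eq_left h₂.le, max_eq_right hlu]
  · rw [min_eq_right (not_lt.mp h₂), max_eq_right (not_lt.mp h₁)]

/-- A function that is nonnegative on `X` and nonpositive off `X` has maximal sum on `X`. -/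
theorem sum_le_sum_of_nonneg_of_nonpos [DecidableEq S] {d : S → ℝ} {X : Finset S}
    (hX : ∀ s ∈ X, 0 ≤ d s) (hXc : ∀ s ∉ X, d s ≤ 0) (F : Finset S) :
    ∑ s ∈ F, d s ≤ ∑ s ∈ X, d s := by
  have h₁ := Finset.sum_inter_add_sum_sdiff F X d
  have h₂ : ∑ s ∈ F \ X, d s ≤ 0 :=
    Finset.sum_nonpos fun s hs => hXc s (Finset.mem_sdiff.mp hs).2
  have h₃ : ∑ s ∈ F ∩ X, d s ≤ ∑ s ∈ X, d s :=
    Finset.sum_le_sum_of_subset_of_nonneg Finset.inter_subset_right fun s hs _ => hX s hs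
  linarith

/-- If `p` is a feasible deviation vector, `Δ = min_{s∈S} w(s)p(s)` and
`δ = max_{s∈S} w(s)p(s) − Δ`, then for every `F ∈ 𝓕` one has
`(c − p^{δ,Δ})(F*) − (c − p^{δ,Δ})(F) ≤ (c − p)(F*) − (c − p)(F) ≤ 0`;
in particular `p^{δ,Δ}` is feasible and `spa_w(p^{δ,Δ}) ≤ δ = spa_w(p)`. -/
theorem stmt1 [Fintype S] [DecidableEq S] [Nonempty S]
    (𝓕 : Finset (Finset S)) (Fstar : Finset S) (hFstar : Fstar ∈ 𝓕)
    (c w : S → ℝ) (hw : ∀ s, 0 < w s)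
    (ℓ u : S → EReal) (hl : ∀ s, ℓ s ≠ ⊤) (hu : ∀ s, u s ≠ ⊥)
    (hlu : ∀ s, ℓ s ≤ u s)
    (p : S → ℝ) (hp : IsFeasible 𝓕 Fstar c ℓ u p)
    (Δ δ : ℝ)
    (hΔ : Δ = univ.inf' univ_nonempty fun s => w s * p s)
    (hδ : δ = (univ.sup' univ_nonempty fun s => w s * p s) - Δ) :
    (∀ F ∈ 𝓕,
        costSum (fun s => c s - pdd Fstar w ℓ u δ Δ s) Fstar -
            costSum (fun s => c s - pdd Fstar w ℓ u δ Δ s) F ≤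
          costSum (fun s => c s - p s) Fstar - costSum (fun s => c s - p s) F ∧
        costSum (fun s => c s - p s) Fstar - costSum (fun s => c s - p s) F ≤ 0) ∧
      IsFeasible 𝓕 Fstar c ℓ u (pdd Fstar w ℓ u δ Δ) ∧
      spa w (pdd Fstar w ℓ u δ Δ) ≤ δ ∧ δ = spa w p := by
  obtain ⟨hopt, hpl, hpu⟩ := hp
  have hδ_spa : δ = spa w p := by rw [hδ, hΔ, spa]
  have hmin : ∀ s, Δ / w s ≤ p s := fun s => by
    rw [div_le_iff₀' (hw s), hΔ]
    exact inf'_le (fun s => w s * p s) (mem_univ s)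
  have hmax : ∀ s, p s ≤ (δ + Δ) / w s := fun s => by
    rw [le_div_iff₀' (hw s), hδ, sub_add_cancel]
    exact le_sup' (fun s => w s * p s) (mem_univ s)
  have hcoe := fun s => coe_pdd Fstar w ℓ u δ Δ (hl s) (hu s) (hlu s)
  have hq_mem : ∀ s ∈ Fstar,
      p s ≤ pdd Fstar w ℓ u δ Δ s ∧ pdd Fstar w ℓ u δ Δ s ≤ (δ + Δ) / w s := fun s hs => by
    have hv := EReal.coe_le_coe_iff.mpr (hmax s)
    rw [← EReal.coe_le_coe_iff, ← EReal.coe_le_coe_iff, hcoe, if_pos hs]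
    exact ⟨le_max_of_le_right (le_min (hpu s) hv),
      max_le ((hpl s).trans hv) (min_le_right _ _)⟩
  have hq_notMem : ∀ s ∉ Fstar,
      Δ / w s ≤ pdd Fstar w ℓ u δ Δ s ∧ pdd Fstar w ℓ u δ Δ s ≤ p s := fun s hs => by
    have hv := EReal.coe_le_coe_iff.mpr (hmin s)
    rw [← EReal.coe_le_coe_iff, ← EReal.coe_le_coe_iff, hcoe, if_neg hs]
    exact ⟨le_max_of_le_right (le_min (hv.trans (hpu s)) le_rfl),
      max_le (hpl s) ((min_le_right _ _).trans hv)⟩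
  have hq_bounds : ∀ s, Δ / w s ≤ pdd Fstar w ℓ u δ Δ s ∧
      pdd Fstar w ℓ u δ Δ s ≤ (δ + Δ) / w s := fun s => by
    by_cases hs : s ∈ Fstar
    · exact ⟨(hmin s).trans (hq_mem s hs).1, (hq_mem s hs).2⟩
    · exact ⟨(hq_notMem s hs).1, (hq_notMem s hs).2.trans (hmax s)⟩
  have hcost : ∀ F ∈ 𝓕,
      costSum (fun s => c s - pdd Fstar w ℓ u δ Δ s) Fstar -
          costSum (fun s => c s - pdd Fstar w ℓ u δ Δ s) F ≤
        costSum (fun s => c s - p s) Fstar - costSum (fun s => c s - p s) F ∧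
      costSum (fun s => c s - p s) Fstar - costSum (fun s => c s - p s) F ≤ 0 := fun F hF => by
    refine ⟨?_, sub_nonpos.mpr (hopt F hF)⟩
    have h := sum_le_sum_of_nonneg_of_nonpos (d := fun s => pdd Fstar w ℓ u δ Δ s - p s)
      (fun s hs => sub_nonneg.mpr (hq_mem s hs).1)
      (fun s hs => sub_nonpos.mpr (hq_notMem s hs).2) F
    simp only [costSum, sum_sub_distrib] at h ⊢
    linarith
  refine ⟨hcost, ⟨fun F hF => ?_, fun s => ?_, fun s => ?_⟩, ?_, hδ_spa⟩
  · exact sub_nonpos.mp ((hcost F hF).1.trans (hcost F hF).2)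
  · rw [hcoe]
    exact le_max_left _ _
  · rw [hcoe]
    exact max_le (hlu s) (min_le_left _ _)
  · have hsup : (univ.sup' univ_nonempty fun s => w s * pdd Fstar w ℓ u δ Δ s) ≤ δ + Δ :=
      sup'_le _ _ fun s _ => (le_div_iff₀' (hw s)).mp (hq_bounds s).2
    have hinf : Δ ≤ univ.inf' univ_nonempty fun s => w s * pdd Fstar w ℓ u δ Δ s :=
      le_inf' _ _ fun s _ => (div_le_iff₀' (hw s)).mp (hq_bounds s).1
    unfold spa
    linarith
end
end

section
/- Assume ℓ and u satisfy (SPEC-LU) with u^in ∈ ℝ and ℓ^out = −∞. Let 𝓖 := {F ∈ 𝓕 : F ∖ S_0 ⊄ F* ∖ S_0}, and set m1' := min_{F ∈ 𝓖} (c(F) − c(F*) + u^in·μ(F* ∖ F))/μ(F ∖ F*) if 𝓖 ≠ ∅, and m1' := 0 otherwise. Then a feasible deviation vector exists if and only if p^{u^in − m1', m1'}_{ℓ,u,w} is a feasible deviation vector. -/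
open Finset

noncomputable section

variable {S : Type*}

/-- `μ(X) = ∑_{s ∈ X ∖ S₀} 1/w(s)`. -/
def muS [DecidableEq S] (w : S → ℝ) (S0 : Finset S) (X : Finset S) : ℝ :=
  ∑ s ∈ X \ S0, 1 / w s

/-- The bound functions `ℓ, u` satisfy (SPEC-LU) with data `S₀, ℓ^in, ℓ^out, u^in, u^out`:
`ℓ(s) = u(s) = 0` on `S₀`; `w(s)ℓ(s) = ℓ^in`, `w(s)u(s) = u^in` on `F* ∖ S₀`;
`w(s)ℓ(s) = ℓ^out`, `w(s)u(s) = u^out` outside `F* ∪ S₀`; together with the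
ordering conditions of the paper. (`ℓ^in, ℓ^out ∈ ℝ ∪ {−∞}` and
`u^in, u^out ∈ ℝ ∪ {+∞}`.) -/
def SpecLU [DecidableEq S] (Fstar : Finset S) (w : S → ℝ) (ℓ u : S → EReal)
    (S0 : Finset S) (lin lout uin uout : EReal) : Prop :=
  (∀ s ∈ S0, ℓ s = 0 ∧ u s = 0) ∧
  (∀ s ∈ Fstar, s ∉ S0 → (w s : EReal) * ℓ s = lin ∧ (w s : EReal) * u s = uin) ∧
  (∀ s, s ∉ Fstar → s ∉ S0 → (w s : EReal) * ℓ s = lout ∧ (w s : EReal) * u s = uout) ∧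
  lin ≤ uin ∧ lout ≤ uout ∧
  ((S0 ∩ Fstar).Nonempty → 0 ≤ lin) ∧
  ((S0 \ Fstar).Nonempty → uout ≤ 0) ∧
  (∀ s ∉ Fstar, ∀ t ∈ Fstar,
      (w s : EReal) * lout ≤ (w t : EReal) * lin ∧
      (w s : EReal) * uout ≤ (w t : EReal) * uin) ∧
  lin ≠ ⊤ ∧ lout ≠ ⊤ ∧ uin ≠ ⊥ ∧ uout ≠ ⊥

/-- An extended real whose product with a positive real `a` is the real `b` is `b / a`. -/
theorem EReal.eq_coe_div_of_coe_mul_eq {a b : ℝ} (ha : 0 < a) {x : EReal}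
    (h : (a : EReal) * x = (b : EReal)) : x = ((b / a : ℝ) : EReal) := by
  induction x with
  | bot => simp [EReal.coe_mul_bot_of_pos ha] at h
  | top => simp [EReal.coe_mul_top_of_pos ha] at h
  | coe r =>
    have h' : a * r = b := by exact_mod_cast h
    rw [EReal.coe_eq_coe_iff, eq_div_iff ha.ne', mul_comm, h']

/-- An extended real whose product with a positive real is `⊥` is itself `⊥`. -/
theorem EReal.eq_bot_of_coe_mul_eq_bot {a : ℝ} (ha : 0 < a) {x : EReal}
    (h : (a : EReal) * x = ⊥) : x = ⊥ := by
  induction x with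
  | bot => rfl
  | top => simp [EReal.coe_mul_top_of_pos ha] at h
  | coe r => exact absurd h (by exact_mod_cast EReal.coe_ne_bot (a * r))

/-- The truncated vector lies in `[ℓ, u]` as soon as `ℓ < ⊤` and `u > ⊥`. -/
theorem pdd_mem_bounds [DecidableEq S] {Fstar : Finset S} {w : S → ℝ} {ℓ u : S → EReal}
    {δ Δ : ℝ} {s : S} (hlu : ℓ s ≤ u s) (hl : ℓ s ≠ ⊤) (hu : u s ≠ ⊥) :
    ℓ s ≤ (pdd Fstar w ℓ u δ Δ s : EReal) ∧ (pdd Fstar w ℓ u δ Δ s : EReal) ≤ u s := by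
  simp only [pdd]
  generalize (if s ∈ Fstar then (δ + Δ) / w s else Δ / w s) = v
  split_ifs with h1 h2
  · rw [EReal.coe_toReal hl (ne_bot_of_gt h1)]
    exact ⟨le_rfl, hlu⟩
  · rw [EReal.coe_toReal (ne_top_of_lt h2) hu]
    exact ⟨hlu, le_rfl⟩
  · exact ⟨not_lt.1 h1, not_lt.1 h2⟩

/-- Optimality of `F*` against `F`, expressed through the two set differences. -/
theorem costSum_sub_le_iff [DecidableEq S] (c p : S → ℝ) (A F : Finset S) :
    costSum (fun s => c s - p s) A ≤ costSum (fun s => c s - p s) F ↔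
      ∑ s ∈ F \ A, p s - ∑ s ∈ A \ F, p s ≤ costSum c F - costSum c A := by
  have h := sum_sdiff_sub_sum_sdiff (s₁ := A) (s₂ := F) (f := p)
  simp only [costSum, sum_sub_distrib]
  constructor <;> intro _ <;> linarith

/-- For `p` vanishing on `S₀`, sums over `X` reduce to sums over `X ∖ S₀`. -/
theorem sum_eq_sum_sdiff_of_eq_zero [DecidableEq S] {p : S → ℝ} {S0 : Finset S}
    (h : ∀ s ∈ S0, p s = 0) (X : Finset S) : ∑ s ∈ X, p s = ∑ s ∈ X \ S0, p s := by
  refine (sum_subset sdiff_subset fun s hs hs' => h s ?_).symm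
  by_contra hs0
  exact hs' (mem_sdiff.2 ⟨hs, hs0⟩)

/-- If `ℓ, u` satisfy (SPEC-LU) with `u^in ∈ ℝ` and `ℓ^out = −∞`, then with
`𝓖 = {F ∈ 𝓕 : F ∖ S₀ ⊄ F* ∖ S₀}` and
`m₁' = min_{F ∈ 𝓖} (c(F) − c(F*) + u^in μ(F* ∖ F)) / μ(F ∖ F*)` (or `0` if `𝓖 = ∅`),
a feasible deviation vector exists iff `p^{u^in − m₁', m₁'}_{ℓ,u,w}` is feasible. -/
theorem stmt4 [Fintype S] [DecidableEq S] [Nonempty S]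
    (𝓕 : Finset (Finset S)) (Fstar : Finset S) (hFstar : Fstar ∈ 𝓕)
    (c w : S → ℝ) (hw : ∀ s, 0 < w s)
    (ℓ u : S → EReal) (hlu : ∀ s, ℓ s ≤ u s)
    (S0 : Finset S) (lin uout : EReal) (uin : ℝ)
    (hspec : SpecLU Fstar w ℓ u S0 lin ⊥ (uin : EReal) uout)
    (m1' : ℝ)
    (hm1 : m1' =
      if h : (𝓕.filter fun F => ¬ (F \ S0 ⊆ Fstar \ S0)).Nonempty then
        (𝓕.filter fun F => ¬ (F \ S0 ⊆ Fstar \ S0)).inf' h fun F =>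
          (costSum c F - costSum c Fstar + uin * muS w S0 (Fstar \ F)) /
            muS w S0 (F \ Fstar)
      else 0) :
    (∃ p : S → ℝ, IsFeasible 𝓕 Fstar c ℓ u p) ↔
      IsFeasible 𝓕 Fstar c ℓ u (pdd Fstar w ℓ u (uin - m1') m1') := by
  refine ⟨?_, fun h => ⟨_, h⟩⟩
  rintro ⟨q, hq, hql, hqu⟩
  obtain ⟨h0, hin, hout, -⟩ := hspec
  have hu_in : ∀ s ∈ Fstar, s ∉ S0 → u s = ((uin / w s : ℝ) : EReal) := fun s hs hs0 =>
    EReal.eq_coe_div_of_coe_mul_eq (hw s) (hin s hs hs0).2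
  have hl_out : ∀ s, s ∉ Fstar → s ∉ S0 → ℓ s = ⊥ := fun s hs hs0 =>
    EReal.eq_bot_of_coe_mul_eq_bot (hw s) (hout s hs hs0).1
  have hl : ∀ s, ℓ s ≠ ⊤ := fun s => ne_top_of_le_ne_top (EReal.coe_ne_top _) (hql s)
  have hu : ∀ s, u s ≠ ⊥ := fun s => ne_bot_of_le_ne_bot (EReal.coe_ne_bot _) (hqu s)
  have hbd := fun s => pdd_mem_bounds (Fstar := Fstar) (w := w) (δ := uin - m1') (Δ := m1')
    (hlu s) (hl s) (hu s)
  have zero_of_bounds : ∀ r : S → ℝ, (∀ s, ℓ s ≤ (r s : EReal)) →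
      (∀ s, (r s : EReal) ≤ u s) → ∀ s ∈ S0, r s = 0 := by
    intro r h1 h2 s hs
    have h1 := h1 s
    have h2 := h2 s
    rw [(h0 s hs).1] at h1
    rw [(h0 s hs).2] at h2
    exact_mod_cast le_antisymm h2 h1
  have hq0 := zero_of_bounds q hql hqu
  have hp0 := zero_of_bounds _ (fun s => (hbd s).1) (fun s => (hbd s).2)
  have hp_in : ∀ s ∈ Fstar, s ∉ S0 →
      pdd Fstar w ℓ u (uin - m1') m1' s = uin * (1 / w s) := by
    intro s hs hs0
    have h1 := hlu s
    rw [hu_in s hs hs0] at h1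
    simp only [pdd, hs, if_true, sub_add_cancel, hu_in s hs hs0, not_lt.2 h1, if_false, lt_irrefl,
      mul_one_div]
  have hp_out : ∀ s, s ∉ Fstar → s ∉ S0 →
      pdd Fstar w ℓ u (uin - m1') m1' s ≤ m1' * (1 / w s) := by
    intro s hs hs0
    simp only [pdd, hs, if_false, hl_out s hs hs0, not_lt_bot, mul_one_div]
    split_ifs with h
    · rw [← EReal.coe_le_coe_iff, EReal.coe_toReal (ne_top_of_lt h) (hu s)]
      exact h.le
    · exact le_rfl
  refine ⟨fun F hF => ?_, fun s => (hbd s).1, fun s => (hbd s).2⟩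
  have hin_sum : ∑ s ∈ Fstar \ F, pdd Fstar w ℓ u (uin - m1') m1' s =
      uin * muS w S0 (Fstar \ F) := by
    rw [sum_eq_sum_sdiff_of_eq_zero hp0, muS, mul_sum]
    refine sum_congr rfl fun s hs => ?_
    simp only [mem_sdiff] at hs
    exact hp_in s hs.1.1 hs.2
  rw [costSum_sub_le_iff, hin_sum]
  by_cases hG : F \ S0 ⊆ Fstar \ S0
  · have hempty : (F \ Fstar) \ S0 = ∅ := by
      rw [sdiff_right_comm, sdiff_eq_empty_iff_subset]
      exact hG.trans sdiff_subset
    have hqF := (costSum_sub_le_iff c q Fstar F).1 (hq F hF)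
    rw [sum_eq_sum_sdiff_of_eq_zero hq0, hempty, sum_empty] at hqF
    rw [sum_eq_sum_sdiff_of_eq_zero hp0, hempty, sum_empty]
    have hle : ∑ s ∈ Fstar \ F, q s ≤ uin * muS w S0 (Fstar \ F) := by
      rw [sum_eq_sum_sdiff_of_eq_zero hq0, muS, mul_sum]
      refine sum_le_sum fun s hs => ?_
      simp only [mem_sdiff] at hs
      have h := hqu s
      rw [hu_in s hs.1.1 hs.2, EReal.coe_le_coe_iff] at h
      rwa [mul_one_div]
    linarith
  · have hmem : F ∈ 𝓕.filter fun F => ¬ (F \ S0 ⊆ Fstar \ S0) := mem_filter.2 ⟨hF, hG⟩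
    have hne : ((F \ Fstar) \ S0).Nonempty := by
      obtain ⟨s, hs, hs'⟩ := not_subset.1 hG
      refine ⟨s, ?_⟩
      simp only [mem_sdiff] at hs hs' ⊢
      tauto
    have hpos : 0 < muS w S0 (F \ Fstar) :=
      sum_pos (fun s _ => one_div_pos.2 (hw s)) hne
    have hm : m1' ≤ (costSum c F - costSum c Fstar + uin * muS w S0 (Fstar \ F)) /
        muS w S0 (F \ Fstar) := by
      rw [hm1, dif_pos ⟨F, hmem⟩]
      exact inf'_le _ hmem
    rw [le_div_iff₀ hpos] at hm
    have hle : ∑ s ∈ F \ Fstar, pdd Fstar w ℓ u (uin - m1') m1' s ≤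
        m1' * muS w S0 (F \ Fstar) := by
      rw [sum_eq_sum_sdiff_of_eq_zero hp0, muS, mul_sum]
      refine sum_le_sum fun s hs => ?_
      simp only [mem_sdiff] at hs
      exact hp_out s hs.1.2 hs.2
    linarith
end
end

section
/- Assume ℓ and u satisfy (SPEC-LU) and that a feasible deviation vector exists. Then there exist δ, Δ ∈ ℝ with ℓ^out ≤ Δ ≤ u^out and ℓ^in ≤ δ + Δ ≤ u^in (inequalities in ℝ ∪ {±∞}) such that p^{δ,Δ}_{ℓ,u,w} is an optimal deviation vector. -/
open Finset

noncomputable section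

variable {S : Type*}

/-- A feasible deviation vector is optimal if it minimizes the weighted span. -/
def IsOptimal [Fintype S] [Nonempty S] (𝓕 : Finset (Finset S)) (Fstar : Finset S)
    (c : S → ℝ) (ℓ u : S → EReal) (w : S → ℝ) (p : S → ℝ) : Prop :=
  IsFeasible 𝓕 Fstar c ℓ u p ∧
    ∀ q, IsFeasible 𝓕 Fstar c ℓ u q → spa w p ≤ spa w q

/-- One step of Fourier–Motzkin elimination: finitely many lower bounds that are pairwise below
finitely many upper bounds can be separated by a single real number. -/
theorem exists_real_between_of_forall_le {ι : Type*} [Finite ι] (P Q : ι → Prop) (f g : ι → ℝ)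
    (h : ∀ i j, P i → Q j → f i ≤ g j) :
    ∃ y, (∀ i, P i → f i ≤ y) ∧ ∀ j, Q j → y ≤ g j := by
  by_cases hP : ∃ i, P i
  · obtain ⟨i, hi, hmax⟩ := Set.exists_max_image {i | P i} f (Set.toFinite _) hP
    exact ⟨f i, hmax, fun j hj => h i j hi hj⟩
  · push Not at hP
    by_cases hQ : ∃ j, Q j
    · obtain ⟨j, -, hmin⟩ := Set.exists_min_image {j | Q j} g (Set.toFinite _) hQ
      exact ⟨g j, fun i hi => absurd hi (hP i), hmin⟩
    · push Not at hQ
      exact ⟨0, fun i hi => absurd hi (hP i), fun j hj => absurd hj (hQ j)⟩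

/-- Eliminating one real variable from finitely many closed constraints that are affine in this
variable leaves a closed set. -/
theorem isClosed_setOf_exists_affine {X ι : Type*} [TopologicalSpace X] [Finite ι]
    (g : ι → X → ℝ) (hg : ∀ i, Continuous (g i)) (a : ι → ℝ) :
    IsClosed {r | ∃ y : ℝ, ∀ i, 0 ≤ g i r + a i * y} := by
  have key : {r | ∃ y : ℝ, ∀ i, 0 ≤ g i r + a i * y} =
      {r | (∀ i, a i = 0 → 0 ≤ g i r) ∧
        ∀ i j, 0 < a i → a j < 0 → -g i r / a i ≤ g j r / -a j} := by
    ext r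
    constructor
    · rintro ⟨y, hy⟩
      refine ⟨fun i hi => by simpa [hi] using hy i, fun i j hi hj => ?_⟩
      have h1 : -g i r / a i ≤ y := by
        rw [div_le_iff₀ hi]; linarith [hy i]
      have h2 : y ≤ g j r / -a j := by
        rw [le_div_iff₀ (by linarith)]; linarith [hy j]
      exact h1.trans h2
    · rintro ⟨h0, hpair⟩
      obtain ⟨y, hl, hu⟩ := exists_real_between_of_forall_le (fun i => 0 < a i) (fun j => a j < 0)
        (fun i => -g i r / a i) (fun j => g j r / -a j) hpair
      refine ⟨y, fun i => ?_⟩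
      rcases lt_trichotomy (a i) 0 with h | h | h
      · have := hu i h
        rw [le_div_iff₀ (by linarith)] at this
        linarith
      · simpa [h] using h0 i h
      · have := hl i h
        rw [div_le_iff₀ h] at this
        linarith
  rw [key]
  simp only [Set.ofPred_and, Set.ofPred_forall]
  refine IsClosed.inter ?_ ?_
  · exact isClosed_iInter fun i => isClosed_iInter fun _ => isClosed_le continuous_const (hg i)
  · exact isClosed_iInter fun i => isClosed_iInter fun j => isClosed_iInter fun _ =>
      isClosed_iInter fun _ => isClosed_le ((hg i).neg.div_const _) ((hg j).div_const _)

theorem EReal.exists_le_coe_iff_affine (l : EReal) :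
    ∃ a b : ℝ, ∀ z : ℝ, l ≤ (z : EReal) ↔ 0 ≤ b + a * z := by
  induction l using EReal.rec with
  | bot => exact ⟨0, 0, fun z => by simp⟩
  | coe x => exact ⟨1, -x, fun z => by
      rw [EReal.coe_le_coe_iff]; constructor <;> intro h <;> linarith⟩
  | top => exact ⟨0, -1, fun z => by simp⟩

theorem EReal.exists_coe_le_iff_affine (l : EReal) :
    ∃ a b : ℝ, ∀ z : ℝ, (z : EReal) ≤ l ↔ 0 ≤ b + a * z := by
  obtain ⟨a, b, h⟩ := EReal.exists_le_coe_iff_affine (-l)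
  refine ⟨-a, b, fun z => ?_⟩
  have := h (-z)
  rw [EReal.coe_neg, EReal.neg_le_neg_iff] at this
  rw [this, mul_neg, neg_mul]

theorem EReal.exists_coe_mem_Icc {l v : EReal} (hlv : l ≤ v) (hl : l ≠ ⊤) (hv : v ≠ ⊥) :
    ∃ x : ℝ, l ≤ (x : EReal) ∧ (x : EReal) ≤ v := by
  induction l using EReal.rec with
  | bot =>
    induction v using EReal.rec with
    | bot => exact absurd rfl hv
    | coe x => exact ⟨x, bot_le, le_rfl⟩
    | top => exact ⟨0, bot_le, le_top⟩
  | coe x => exact ⟨x, le_rfl, hlv⟩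
  | top => exact absurd rfl hl

theorem isClosed_setOf_exists_isFeasible_add [Fintype S] (𝓕 : Finset (Finset S))
    (Fstar : Finset S) (c w : S → ℝ) (ℓ u : S → EReal) :
    IsClosed {r : S → ℝ | ∃ y : ℝ, IsFeasible 𝓕 Fstar c ℓ u fun s => r s + y / w s} := by
  choose al bl hl using fun s => EReal.exists_le_coe_iff_affine (ℓ s)
  choose au bu hu using fun s => EReal.exists_coe_le_iff_affine (u s)
  let g : 𝓕 ⊕ S ⊕ S → (S → ℝ) → ℝ := Sum.elim
    (fun F r => costSum (fun s => c s - r s) F.1 - costSum (fun s => c s - r s) Fstar)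
    (Sum.elim (fun s r => bl s + al s * r s) (fun s r => bu s + au s * r s))
  let a : 𝓕 ⊕ S ⊕ S → ℝ := Sum.elim
    (fun F => costSum (fun s => 1 / w s) Fstar - costSum (fun s => 1 / w s) F.1)
    (Sum.elim (fun s => al s / w s) (fun s => au s / w s))
  have hg : ∀ i, Continuous (g i) := by
    rintro (F | s | s) <;> simp only [g, Sum.elim_inl, Sum.elim_inr, costSum] <;> fun_prop
  convert isClosed_setOf_exists_affine g hg a using 5 with r y
  have hsum : ∀ X : Finset S, costSum (fun s => c s - (r s + y / w s)) X =
      costSum (fun s => c s - r s) X - costSum (fun s => 1 / w s) X * y := by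
    intro X
    simp only [costSum, Finset.sum_mul, ← Finset.sum_sub_distrib]
    exact Finset.sum_congr rfl fun s _ => by ring
  simp only [IsFeasible, Sum.forall, g, a, Sum.elim_inl, Sum.elim_inr, Subtype.forall, hsum, hl, hu]
  refine and_congr (forall₂_congr fun F _ => ?_)
    (and_congr (forall_congr' fun s => ?_) (forall_congr' fun s => ?_))
  · constructor <;> intro h <;> linarith
  · rw [show bl s + al s * (r s + y / w s) = bl s + al s * r s + al s / w s * y by ring]
  · rw [show bu s + au s * (r s + y / w s) = bu s + au s * r s + au s / w s * y by ring]

theorem le_spa [Fintype S] [Nonempty S] (w p : S → ℝ) (s t : S) :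
    w s * p s - w t * p t ≤ spa w p :=
  sub_le_sub (Finset.le_sup' (fun s => w s * p s) (mem_univ s))
    (Finset.inf'_le (fun s => w s * p s) (mem_univ t))

theorem spa_le_iff [Fintype S] [Nonempty S] (w p : S → ℝ) (M : ℝ) :
    spa w p ≤ M ↔ ∀ s t, w s * p s - w t * p t ≤ M := by
  refine ⟨fun h s t => (le_spa w p s t).trans h, fun h => ?_⟩
  obtain ⟨s, -, hs⟩ := Finset.exists_mem_eq_sup' univ_nonempty fun s => w s * p s
  obtain ⟨t, -, ht⟩ := Finset.exists_mem_eq_inf' univ_nonempty fun s => w s * p s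
  rw [spa, hs, ht]
  exact h s t

theorem spa_add_div [Fintype S] [Nonempty S] {w : S → ℝ} (hw : ∀ s, 0 < w s) (r : S → ℝ)
    (y : ℝ) : spa w (fun s => r s + y / w s) = spa w r := by
  refine eq_of_forall_ge_iff fun M => ?_
  have h : ∀ s, w s * (r s + y / w s) = w s * r s + y := fun s => by
    have := (hw s).ne'
    field_simp
  simp only [spa_le_iff, h, add_sub_add_right_eq_sub]

theorem continuous_spa [Fintype S] [Nonempty S] (w : S → ℝ) : Continuous (spa w) := by
  unfold spa
  exact (Continuous.finset_sup'_apply _ fun s _ => by fun_prop).sub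
    (Continuous.finset_inf'_apply _ fun s _ => by fun_prop)

/-- For arbitrary bounds, an optimal deviation vector exists as soon as a feasible one does. -/
theorem exists_isOptimal [Fintype S] [Nonempty S] (𝓕 : Finset (Finset S))
    (Fstar : Finset S) (c : S → ℝ) {w : S → ℝ} (hw : ∀ s, 0 < w s) (ℓ u : S → EReal)
    (hex : ∃ p : S → ℝ, IsFeasible 𝓕 Fstar c ℓ u p) :
    ∃ p, IsOptimal 𝓕 Fstar c ℓ u w p := by
  obtain ⟨q₀, hq₀⟩ := hex
  let R := {r : S → ℝ | ∃ y : ℝ, IsFeasible 𝓕 Fstar c ℓ u fun s => r s + y / w s}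
  let K := (Set.univ.pi fun s => Set.Icc 0 (spa w q₀ / w s)) ∩ R
  have hK : IsCompact K := (isCompact_univ_pi fun _ => isCompact_Icc).inter_right
    (isClosed_setOf_exists_isFeasible_add 𝓕 Fstar c w ℓ u)
  have hmem : ∀ q, IsFeasible 𝓕 Fstar c ℓ u q → spa w q ≤ spa w q₀ →
      ∃ r ∈ K, spa w r = spa w q := by
    intro q hq hle
    obtain ⟨t, -, ht⟩ := Finset.exists_min_image univ (fun s => w s * q s) univ_nonempty
    have hr : ∀ s, q s + -(w t * q t) / w s = (w s * q s - w t * q t) / w s := fun s => by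
      have := (hw s).ne'
      field_simp
      ring
    refine ⟨fun s => q s + -(w t * q t) / w s, ⟨fun s _ => ?_, w t * q t, ?_⟩,
      spa_add_div hw q _⟩
    · simp only [hr]
      exact ⟨div_nonneg (sub_nonneg.2 (ht s (mem_univ s))) (hw s).le,
        div_le_div_of_nonneg_right ((le_spa w q s t).trans hle) (hw s).le⟩
    · simpa only [neg_div, neg_add_cancel_right] using hq
  obtain ⟨r₀, hr₀, -⟩ := hmem q₀ hq₀ le_rfl
  obtain ⟨r, hrK, hmin⟩ := hK.exists_isMinOn ⟨r₀, hr₀⟩ (continuous_spa w).continuousOn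
  obtain ⟨y, hy⟩ := hrK.2
  have hopt : ∀ q, IsFeasible 𝓕 Fstar c ℓ u q → spa w q ≤ spa w q₀ → spa w r ≤ spa w q := by
    intro q hq hle
    obtain ⟨r', hr', h⟩ := hmem q hq hle
    exact (hmin hr').trans_eq h
  refine ⟨_, hy, fun q hq => ?_⟩
  rw [spa_add_div hw]
  rcases le_total (spa w q) (spa w q₀) with h | h
  · exact hopt q hq h
  · exact (hopt q₀ hq₀ le_rfl).trans h

/-- Raising a feasible deviation vector on `F*` and lowering it elsewhere, within the bounds,
keeps it feasible. -/
theorem IsFeasible.of_le_of_ge [DecidableEq S] {𝓕 : Finset (Finset S)} {Fstar : Finset S}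
    {c : S → ℝ} {ℓ u : S → EReal} {p q : S → ℝ} (hq : IsFeasible 𝓕 Fstar c ℓ u q)
    (hin : ∀ s ∈ Fstar, q s ≤ p s) (hout : ∀ s ∉ Fstar, p s ≤ q s)
    (hl : ∀ s, ℓ s ≤ (p s : EReal)) (hu : ∀ s, (p s : EReal) ≤ u s) :
    IsFeasible 𝓕 Fstar c ℓ u p := by
  refine ⟨fun F hF => ?_, hl, hu⟩
  have h := hq.1 F hF
  simp only [costSum] at h ⊢
  rw [← Finset.sum_sdiff_le_sum_sdiff] at h ⊢
  calc ∑ s ∈ Fstar \ F, (c s - p s) ≤ ∑ s ∈ Fstar \ F, (c s - q s) :=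
        Finset.sum_le_sum fun s hs => by linarith [hin s (mem_sdiff.1 hs).1]
    _ ≤ ∑ s ∈ F \ Fstar, (c s - q s) := h
    _ ≤ ∑ s ∈ F \ Fstar, (c s - p s) :=
        Finset.sum_le_sum fun s hs => by linarith [hout s (mem_sdiff.1 hs).2]

theorem pdd_eq_of_mem [DecidableEq S] {Fstar : Finset S} {w : S → ℝ} {ℓ u : S → EReal}
    {δ Δ : ℝ} {s : S}
    (hl : ℓ s ≤ ((if s ∈ Fstar then (δ + Δ) / w s else Δ / w s : ℝ) : EReal))
    (hu : ((if s ∈ Fstar then (δ + Δ) / w s else Δ / w s : ℝ) : EReal) ≤ u s) :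
    pdd Fstar w ℓ u δ Δ s = if s ∈ Fstar then (δ + Δ) / w s else Δ / w s := by
  simp only [pdd, if_neg hl.not_gt, if_neg hu.not_gt]

theorem pdd_eq_zero [DecidableEq S] {Fstar : Finset S} {w : S → ℝ} {ℓ u : S → EReal}
    {δ Δ : ℝ} {s : S} (hl : ℓ s = 0) (hu : u s = 0) : pdd Fstar w ℓ u δ Δ s = 0 := by
  simp only [pdd, hl, hu, EReal.toReal_zero]
  split_ifs with _ h1 h2 <;> first
    | rfl
    | exact le_antisymm (EReal.coe_le_coe_iff.1 (not_lt.1 ‹¬ (0 : EReal) < _›))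
        (EReal.coe_le_coe_iff.1 (not_lt.1 ‹¬ _ < (0 : EReal)›))

theorem EReal.coe_mul_le_coe_mul_iff {a : ℝ} (ha : 0 < a) {x y : EReal} :
    (a : EReal) * x ≤ a * y ↔ x ≤ y := by
  refine ⟨fun h => ?_, fun h => mul_le_mul_of_nonneg_left h (EReal.coe_nonneg.2 ha.le)⟩
  have hinv : ∀ z : EReal, ((a⁻¹ : ℝ) : EReal) * (a * z) = z := fun z => by
    rw [← mul_assoc, ← EReal.coe_mul, inv_mul_cancel₀ ha.ne', EReal.coe_one, one_mul]
  have := mul_le_mul_of_nonneg_left h (EReal.coe_nonneg.2 (inv_pos.2 ha).le)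
  rwa [hinv, hinv] at this

/-- Common value for a group `T` of elements sharing the same scaled bounds: the value of
`w·q` on `T` maximizing `σ·w·q`, or an arbitrary admissible value when `T` is empty. -/
theorem exists_extreme_value {w q : S → ℝ} (σ : ℝ) {T : Finset S} {l v : EReal} (hlv : l ≤ v)
    (hl : l ≠ ⊤) (hv : v ≠ ⊥)
    (hT : ∀ s ∈ T, l ≤ ((w s * q s : ℝ) : EReal) ∧ ((w s * q s : ℝ) : EReal) ≤ v) :
    ∃ x : ℝ, l ≤ (x : EReal) ∧ (x : EReal) ≤ v ∧
      (∀ s ∈ T, σ * (w s * q s) ≤ σ * x) ∧ (T.Nonempty → ∃ t, x = w t * q t) := by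
  rcases T.eq_empty_or_nonempty with rfl | hne
  · obtain ⟨x, h1, h2⟩ := EReal.exists_coe_mem_Icc hlv hl hv
    exact ⟨x, h1, h2, by simp, by simp⟩
  · obtain ⟨t, htT, ht⟩ := Finset.exists_max_image T (fun s => σ * (w s * q s)) hne
    exact ⟨w t * q t, (hT t htT).1, (hT t htT).2, ht, fun _ => ⟨t, rfl⟩⟩

/-- Every feasible deviation vector is dominated by one of the form `pdd`. -/
theorem SpecLU.exists_pdd_spa_le [Fintype S] [DecidableEq S] [Nonempty S]
    {𝓕 : Finset (Finset S)} {Fstar : Finset S} {c w : S → ℝ} (hw : ∀ s, 0 < w s)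
    {ℓ u : S → EReal} {S0 : Finset S} {lin lout uin uout : EReal}
    (hspec : SpecLU Fstar w ℓ u S0 lin lout uin uout) {q : S → ℝ}
    (hq : IsFeasible 𝓕 Fstar c ℓ u q) :
    ∃ δ Δ : ℝ,
      lout ≤ (Δ : EReal) ∧ (Δ : EReal) ≤ uout ∧
      lin ≤ ((δ + Δ : ℝ) : EReal) ∧ ((δ + Δ : ℝ) : EReal) ≤ uin ∧
      IsFeasible 𝓕 Fstar c ℓ u (pdd Fstar w ℓ u δ Δ) ∧
      spa w (pdd Fstar w ℓ u δ Δ) ≤ spa w q := by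
  obtain ⟨hS0, hFin, hFout, hin, hout, -, -, -, hlin, hlout, huin, huout⟩ := hspec
  have scale_l : ∀ s (x : ℝ), (w s : EReal) * ℓ s ≤ ((w s * x : ℝ) : EReal) ↔ ℓ s ≤ x :=
    fun s x => by rw [EReal.coe_mul, EReal.coe_mul_le_coe_mul_iff (hw s)]
  have scale_u : ∀ s (x : ℝ), ((w s * x : ℝ) : EReal) ≤ (w s : EReal) * u s ↔ x ≤ u s :=
    fun s x => by rw [EReal.coe_mul, EReal.coe_mul_le_coe_mul_iff (hw s)]
  obtain ⟨x, hlx, hxu, hx, hxq⟩ := exists_extreme_value (w := w) (q := q) (T := Fstar \ S0) 1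
    hin hlin huin fun s hs => by
      obtain ⟨h1, h2⟩ := mem_sdiff.1 hs
      rw [← (hFin s h1 h2).1, ← (hFin s h1 h2).2, scale_l, scale_u]
      exact ⟨hq.2.1 s, hq.2.2 s⟩
  obtain ⟨y, hly, hyu, hy, hyq⟩ := exists_extreme_value (w := w) (q := q) (T := Fstarᶜ \ S0) (-1)
    hout hlout huout fun s hs => by
      obtain ⟨h1, h2⟩ := mem_sdiff.1 hs
      rw [mem_compl] at h1
      rw [← (hFout s h1 h2).1, ← (hFout s h1 h2).2, scale_l, scale_u]
      exact ⟨hq.2.1 s, hq.2.2 s⟩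
  have hw_div : ∀ s (z : ℝ), w s * (z / w s) = z := fun s z => mul_div_cancel₀ z (hw s).ne'
  have hxy : x - y + y = x := sub_add_cancel x y
  have hp0 : ∀ s ∈ S0, pdd Fstar w ℓ u (x - y) y s = 0 ∧ q s = 0 := fun s hs => by
    obtain ⟨h1, h2⟩ := hS0 s hs
    have hl := hq.2.1 s
    have hu := hq.2.2 s
    rw [h1] at hl
    rw [h2] at hu
    exact ⟨pdd_eq_zero h1 h2, le_antisymm (EReal.coe_nonpos.1 hu) (EReal.coe_nonneg.1 hl)⟩
  have hbin : ∀ s ∈ Fstar, s ∉ S0 →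
      ℓ s ≤ ((x / w s : ℝ) : EReal) ∧ ((x / w s : ℝ) : EReal) ≤ u s := fun s h1 h2 => by
    rw [← scale_l, ← scale_u, hw_div, (hFin s h1 h2).1, (hFin s h1 h2).2]
    exact ⟨hlx, hxu⟩
  have hbout : ∀ s ∉ Fstar, s ∉ S0 →
      ℓ s ≤ ((y / w s : ℝ) : EReal) ∧ ((y / w s : ℝ) : EReal) ≤ u s := fun s h1 h2 => by
    rw [← scale_l, ← scale_u, hw_div, (hFout s h1 h2).1, (hFout s h1 h2).2]
    exact ⟨hly, hyu⟩
  have hpin : ∀ s ∈ Fstar, s ∉ S0 → pdd Fstar w ℓ u (x - y) y s = x / w s := fun s h1 h2 => by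
    rw [pdd_eq_of_mem, if_pos h1, hxy] <;> rw [if_pos h1, hxy]
    exacts [(hbin s h1 h2).1, (hbin s h1 h2).2]
  have hpout : ∀ s ∉ Fstar, s ∉ S0 → pdd Fstar w ℓ u (x - y) y s = y / w s := fun s h1 h2 => by
    rw [pdd_eq_of_mem, if_neg h1] <;> rw [if_neg h1]
    exacts [(hbout s h1 h2).1, (hbout s h1 h2).2]
  have hbounds : ∀ s, ℓ s ≤ (pdd Fstar w ℓ u (x - y) y s : EReal) ∧
      (pdd Fstar w ℓ u (x - y) y s : EReal) ≤ u s := fun s => by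
    by_cases h0 : s ∈ S0
    · simp [(hp0 s h0).1, hS0 s h0]
    · by_cases hs : s ∈ Fstar
      · rw [hpin s hs h0]
        exact hbin s hs h0
      · rw [hpout s hs h0]
        exact hbout s hs h0
  have hval : ∀ s, ∃ t, w s * pdd Fstar w ℓ u (x - y) y s = w t * q t := fun s => by
    by_cases h0 : s ∈ S0
    · exact ⟨s, by rw [(hp0 s h0).1, (hp0 s h0).2]⟩
    · by_cases hs : s ∈ Fstar
      · rw [hpin s hs h0, hw_div]
        exact hxq ⟨s, mem_sdiff.2 ⟨hs, h0⟩⟩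
      · rw [hpout s hs h0, hw_div]
        exact hyq ⟨s, mem_sdiff.2 ⟨mem_compl.2 hs, h0⟩⟩
  refine ⟨x - y, y, hly, hyu, by rwa [hxy], by rwa [hxy],
    hq.of_le_of_ge (fun s hs => ?_) (fun s hs => ?_) (fun s => (hbounds s).1)
      (fun s => (hbounds s).2), (spa_le_iff _ _ _).2 fun s t => ?_⟩
  · by_cases h0 : s ∈ S0
    · rw [(hp0 s h0).1, (hp0 s h0).2]
    · rw [hpin s hs h0, le_div_iff₀ (hw s)]
      linarith [hx s (mem_sdiff.2 ⟨hs, h0⟩)]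
  · by_cases h0 : s ∈ S0
    · rw [(hp0 s h0).1, (hp0 s h0).2]
    · rw [hpout s hs h0, div_le_iff₀ (hw s)]
      linarith [hy s (mem_sdiff.2 ⟨mem_compl.2 hs, h0⟩)]
  · obtain ⟨s', hs'⟩ := hval s
    obtain ⟨t', ht'⟩ := hval t
    rw [hs', ht']
    exact le_spa w q s' t'

/-- If `ℓ, u` satisfy (SPEC-LU) and a feasible deviation vector exists, then there
exist `δ, Δ ∈ ℝ` with `ℓ^out ≤ Δ ≤ u^out` and `ℓ^in ≤ δ + Δ ≤ u^in`
(inequalities in `ℝ ∪ {±∞}`) such that `p^{δ,Δ}_{ℓ,u,w}` is optimal. -/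
theorem stmt7 [Fintype S] [DecidableEq S] [Nonempty S]
    (𝓕 : Finset (Finset S)) (Fstar : Finset S) (hFstar : Fstar ∈ 𝓕)
    (c w : S → ℝ) (hw : ∀ s, 0 < w s)
    (ℓ u : S → EReal) (hlu : ∀ s, ℓ s ≤ u s)
    (S0 : Finset S) (lin lout uin uout : EReal)
    (hspec : SpecLU Fstar w ℓ u S0 lin lout uin uout)
    (hex : ∃ p : S → ℝ, IsFeasible 𝓕 Fstar c ℓ u p) :
    ∃ δ Δ : ℝ,
      lout ≤ (Δ : EReal) ∧ (Δ : EReal) ≤ uout ∧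
      lin ≤ ((δ + Δ : ℝ) : EReal) ∧ ((δ + Δ : ℝ) : EReal) ≤ uin ∧
      IsOptimal 𝓕 Fstar c ℓ u w (pdd Fstar w ℓ u δ Δ) := by
  obtain ⟨q, hq, hqopt⟩ := exists_isOptimal 𝓕 Fstar c hw ℓ u hex
  obtain ⟨δ, Δ, h1, h2, h3, h4, hfeas, hle⟩ := hspec.exists_pdd_spa_le hw hq
  exact ⟨δ, Δ, h1, h2, h3, h4, hfeas, fun q' hq' => hle.trans (hqopt q' hq')⟩
end
end

section
/- Min–max theorem for the minimum weighted span (unconstrained, multiple cost functions): Assume at least one feasible deviation vector exists. Let A be the finite set of real numbers consisting of 0, together with all values (c^j(F*) − c^j(F''))/(1/w)(F* ∖ F'') where j ∈ {1,…,k} and F'' ∈ 𝓕 satisfies F'' ≠ F* and (1/w)(F'') = (1/w)(F*), and together with all values [ (c^{j1}(F*) − c^{j1}(F'))/((1/w)(F*) − (1/w)(F')) − (c^{j2}(F*) − c^{j2}(F'''))/((1/w)(F*) − (1/w)(F''')) ] / [ (1/w)(F* ∖ F')/((1/w)(F*) − (1/w)(F')) − (1/w)(F* ∖ F''')/((1/w)(F*)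 − (1/w)(F''')) ] where j1, j2 ∈ {1,…,k} and F', F''' ∈ 𝓕 satisfy (1/w)(F') < (1/w)(F*) < (1/w)(F'''). Then the set { spa_w(p) : p a feasible deviation vector } has a least element, and this minimum equals max A. -/
open Finset

noncomputable section

variable {S : Type*}

/-- `(1/w)(X) = ∑_{s∈X} 1/w(s)`. -/
def invw (w : S → ℝ) (X : Finset S) : ℝ := ∑ s ∈ X, 1 / w s

/-- A deviation vector `p` is feasible (no bound constraints) for the cost
functions `c^1, …, c^k` if `F*` has minimum `(c^j − p)`-cost in `𝓕` for all `j`. -/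
def FeasibleU (𝓕 : Finset (Finset S)) (Fstar : Finset S) {k : ℕ}
    (c : Fin k → S → ℝ) (p : S → ℝ) : Prop :=
  ∀ j : Fin k, ∀ F ∈ 𝓕,
    costSum (fun s => c j s - p s) Fstar ≤ costSum (fun s => c j s - p s) F

/-- Finitely many lower bounds, each at most each of finitely many upper bounds, can be
separated by a single element. -/
theorem exists_between_of_finite {s t : Set ℝ} (hs : s.Finite) (ht : t.Finite)
    (h : ∀ x ∈ s, ∀ y ∈ t, x ≤ y) : ∃ d, (∀ x ∈ s, x ≤ d) ∧ ∀ y ∈ t, d ≤ y := by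
  rcases s.eq_empty_or_nonempty with rfl | hne
  · obtain ⟨d, hd⟩ := ht.bddBelow
    exact ⟨d, by simp, fun y hy => hd hy⟩
  · obtain ⟨d, hds, hd⟩ := Set.exists_max_image s id hs hne
    exact ⟨d, hd, fun y hy => h d hds y hy⟩

theorem costSum_sub (c p : S → ℝ) (X : Finset S) :
    costSum (fun s => c s - p s) X = costSum c X - costSum p X := by
  simp [costSum, sum_sub_distrib]

theorem costSum_sub_costSum [DecidableEq S] (p : S → ℝ) (X Y : Finset S) :
    costSum p X - costSum p Y = costSum p (X \ Y) - costSum p (Y \ X) := by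
  have h₁ := sum_inter_add_sum_sdiff X Y p
  have h₂ := sum_inter_add_sum_sdiff Y X p
  rw [inter_comm] at h₂
  unfold costSum
  linarith

theorem invw_sub_invw [DecidableEq S] (w : S → ℝ) (X Y : Finset S) :
    invw w X - invw w Y = invw w (X \ Y) - invw w (Y \ X) :=
  costSum_sub_costSum (fun s => 1 / w s) X Y

theorem invw_nonneg {w : S → ℝ} (hw : ∀ s, 0 < w s) (X : Finset S) : 0 ≤ invw w X :=
  sum_nonneg fun s _ => (one_div_pos.2 (hw s)).le

theorem invw_pos {w : S → ℝ} (hw : ∀ s, 0 < w s) {X : Finset S} (hX : X.Nonempty) :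
    0 < invw w X :=
  sum_pos (fun s _ => one_div_pos.2 (hw s)) hX

theorem invw_sdiff_pos [DecidableEq S] {w : S → ℝ} (hw : ∀ s, 0 < w s) {X Y : Finset S}
    (hne : Y ≠ X) (h : invw w Y = invw w X) : 0 < invw w (X \ Y) := by
  by_contra! hle
  have h₀ : ∀ Z : Finset S, invw w Z ≤ 0 → Z = ∅ := fun Z hZ =>
    not_nonempty_iff_eq_empty.1 fun hn => (invw_pos hw hn).not_ge hZ
  have h₁ := invw_sub_invw w X Y
  exact hne (Subset.antisymm (sdiff_eq_empty_iff_subset.1 (h₀ _ (by linarith)))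
    (sdiff_eq_empty_iff_subset.1 (h₀ _ hle)))

theorem costSum_le_mul_invw {w p : S → ℝ} (hw : ∀ s, 0 < w s) {b : ℝ}
    (h : ∀ s, w s * p s ≤ b) (X : Finset S) : costSum p X ≤ b * invw w X := by
  rw [costSum, invw, mul_sum]
  refine sum_le_sum fun s _ => ?_
  rw [mul_one_div, le_div_iff₀ (hw s), mul_comm]
  exact h s

theorem mul_invw_le_costSum {w p : S → ℝ} (hw : ∀ s, 0 < w s) {b : ℝ}
    (h : ∀ s, b ≤ w s * p s) (X : Finset S) : b * invw w X ≤ costSum p X := by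
  rw [costSum, invw, mul_sum]
  refine sum_le_sum fun s _ => ?_
  rw [mul_one_div, div_le_iff₀ (hw s), mul_comm]
  exact h s

/-- The linear system satisfied by a span `δ` and a lower value `Δ` of a feasible deviation
vector. -/
def SpanFeasible [DecidableEq S] (𝓕 : Finset (Finset S)) (Fstar : Finset S) {k : ℕ}
    (c : Fin k → S → ℝ) (w : S → ℝ) (δ Δ : ℝ) : Prop :=
  ∀ j : Fin k, ∀ F ∈ 𝓕, costSum (c j) Fstar - costSum (c j) F ≤
    δ * invw w (Fstar \ F) + Δ * (invw w Fstar - invw w F)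

theorem spa_nonneg [Fintype S] [Nonempty S] (w p : S → ℝ) : 0 ≤ spa w p := by
  obtain ⟨s⟩ := ‹Nonempty S›
  exact sub_nonneg.2 ((inf'_le _ (mem_univ s)).trans
    (le_sup' (fun s => w s * p s) (mem_univ s)))

theorem FeasibleU.exists_spanFeasible [Fintype S] [DecidableEq S] [Nonempty S]
    {𝓕 : Finset (Finset S)} {Fstar : Finset S} {k : ℕ} {c : Fin k → S → ℝ} {w p : S → ℝ}
    (hw : ∀ s, 0 < w s) (hp : FeasibleU 𝓕 Fstar c p) :
    ∃ Δ, SpanFeasible 𝓕 Fstar c w (spa w p) Δ := by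
  refine ⟨univ.inf' univ_nonempty fun s => w s * p s, fun j F hF => ?_⟩
  have h := hp j F hF
  rw [costSum_sub, costSum_sub] at h
  have hmax : ∀ s, w s * p s ≤ univ.sup' univ_nonempty fun s => w s * p s :=
    fun s => le_sup' (fun s => w s * p s) (mem_univ s)
  have hmin : ∀ s, (univ.inf' univ_nonempty fun s => w s * p s) ≤ w s * p s :=
    fun s => inf'_le (fun s => w s * p s) (mem_univ s)
  have h₁ := costSum_le_mul_invw hw hmax (Fstar \ F)
  have h₂ := mul_invw_le_costSum hw hmin (F \ Fstar)
  have h₃ := costSum_sub_costSum p Fstar F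
  rw [invw_sub_invw, spa]
  linarith

theorem SpanFeasible.exists_feasibleU [Fintype S] [DecidableEq S] [Nonempty S]
    {𝓕 : Finset (Finset S)} {Fstar : Finset S} {k : ℕ} {c : Fin k → S → ℝ} {w : S → ℝ}
    (hw : ∀ s, 0 < w s) {δ Δ : ℝ} (hδ : 0 ≤ δ) (h : SpanFeasible 𝓕 Fstar c w δ Δ) :
    ∃ p, FeasibleU 𝓕 Fstar c p ∧ spa w p ≤ δ := by
  set p : S → ℝ := fun s => (if s ∈ Fstar then Δ + δ else Δ) * (1 / w s) with hp
  have hwp : ∀ s, w s * p s = if s ∈ Fstar then Δ + δ else Δ := fun s => by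
    have := (hw s).ne'
    simp only [hp]
    field_simp
  refine ⟨p, fun j F hF => ?_, ?_⟩
  · have h₁ : costSum p (Fstar \ F) = (Δ + δ) * invw w (Fstar \ F) := by
      rw [costSum, invw, mul_sum]
      exact sum_congr rfl fun s hs => by simp only [hp, if_pos (mem_sdiff.1 hs).1]
    have h₂ : costSum p (F \ Fstar) = Δ * invw w (F \ Fstar) := by
      rw [costSum, invw, mul_sum]
      exact sum_congr rfl fun s hs => by simp only [hp, if_neg (mem_sdiff.1 hs).2]
    have h₃ := costSum_sub_costSum p Fstar F
    have h₄ := h j F hF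
    rw [invw_sub_invw] at h₄
    rw [costSum_sub, costSum_sub]
    linarith
  · have h₁ : (univ.sup' univ_nonempty fun s => w s * p s) ≤ Δ + δ :=
      sup'_le _ _ fun s _ => by rw [hwp]; split_ifs <;> linarith
    have h₂ : Δ ≤ univ.inf' univ_nonempty fun s => w s * p s :=
      le_inf' _ _ fun s _ => by rw [hwp]; split_ifs <;> linarith
    rw [spa]
    linarith

/-- Eliminating `Δ` from a pair of constraints whose coefficients `d₁` and `d₂` of `Δ` have
opposite signs; `a₁` and `a₂` are the coefficients of `δ`. -/
theorem elimination_le_iff {C₁ C₂ a₁ a₂ d₁ d₂ δ : ℝ} (hd₁ : 0 < d₁) (hd₂ : d₂ < 0)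
    (ha₁ : 0 < a₁) (ha₂ : 0 ≤ a₂) :
    (C₁ / d₁ - C₂ / d₂) / (a₁ / d₁ - a₂ / d₂) ≤ δ ↔
      (C₁ - δ * a₁) / d₁ ≤ (C₂ - δ * a₂) / d₂ := by
  have h₁ : 0 < a₁ / d₁ := div_pos ha₁ hd₁
  have h₂ : a₂ / d₂ ≤ 0 := div_nonpos_of_nonneg_of_nonpos ha₂ hd₂.le
  rw [div_le_iff₀ (by linarith), sub_div, sub_div, mul_div_assoc, mul_div_assoc]
  constructor <;> intro h <;> linarith

/-- Min–max theorem for the minimum weighted span (unconstrained, multiple cost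
functions): if a feasible deviation vector exists, the set of weighted spans of
feasible deviation vectors has a least element, and this minimum equals the
maximum of the set `A` described in the statement. -/
theorem stmt8 [Fintype S] [DecidableEq S] [Nonempty S]
    (𝓕 : Finset (Finset S)) (Fstar : Finset S) (hFstar : Fstar ∈ 𝓕)
    (k : ℕ) (hk : 1 ≤ k) (c : Fin k → S → ℝ)
    (w : S → ℝ) (hw : ∀ s, 0 < w s)
    (hex : ∃ p : S → ℝ, FeasibleU 𝓕 Fstar c p)
    (A : Set ℝ)
    (hA : A = {0} ∪
        {x | ∃ j : Fin k, ∃ F'' ∈ 𝓕, F'' ≠ Fstar ∧ invw w F'' = invw w Fstar ∧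
          x = (costSum (c j) Fstar - costSum (c j) F'') / invw w (Fstar \ F'')} ∪
        {x | ∃ j1 j2 : Fin k, ∃ F' ∈ 𝓕, ∃ F''' ∈ 𝓕,
          invw w F' < invw w Fstar ∧ invw w Fstar < invw w F''' ∧
          x = ((costSum (c j1) Fstar - costSum (c j1) F') /
                  (invw w Fstar - invw w F') -
               (costSum (c j2) Fstar - costSum (c j2) F''') /
                  (invw w Fstar - invw w F''')) /
              (invw w (Fstar \ F') / (invw w Fstar - invw w F') -
               invw w (Fstar \ F''') / (invw w Fstar - invw w F'''))}) :
    ∃ m : ℝ,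
      IsLeast {x : ℝ | ∃ p : S → ℝ, FeasibleU 𝓕 Fstar c p ∧ spa w p = x} m ∧
      IsGreatest A m := by
  have hsdiff_pos : ∀ F, invw w F < invw w Fstar → 0 < invw w (Fstar \ F) := fun F hF => by
    have h₁ := invw_sub_invw w Fstar F
    have h₂ := invw_nonneg hw (F \ Fstar)
    linarith
  have hfin : A.Finite := by
    rw [hA]
    refine ((Set.finite_singleton 0).union ?_).union ?_
    · refine (Set.finite_range fun q : Fin k × Finset S =>
        (costSum (c q.1) Fstar - costSum (c q.1) q.2) / invw w (Fstar \ q.2)).subset ?_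
      rintro x ⟨j, F, -, -, -, rfl⟩
      exact ⟨(j, F), rfl⟩
    · refine (Set.finite_range fun q : (Fin k × Fin k) × (Finset S × Finset S) =>
        ((costSum (c q.1.1) Fstar - costSum (c q.1.1) q.2.1) / (invw w Fstar - invw w q.2.1) -
          (costSum (c q.1.2) Fstar - costSum (c q.1.2) q.2.2) /
            (invw w Fstar - invw w q.2.2)) /
        (invw w (Fstar \ q.2.1) / (invw w Fstar - invw w q.2.1) -
          invw w (Fstar \ q.2.2) / (invw w Fstar - invw w q.2.2))).subset ?_
      rintro x ⟨j₁, j₂, F₁, -, F₂, -, -, -, rfl⟩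
      exact ⟨((j₁, j₂), (F₁, F₂)), rfl⟩
  have h0A : (0 : ℝ) ∈ A := by rw [hA]; exact Or.inl (Or.inl rfl)
  obtain ⟨m, hmA, hmax⟩ := Set.exists_max_image A id hfin ⟨0, h0A⟩
  have hle : ∀ p, FeasibleU 𝓕 Fstar c p → ∀ x ∈ A, x ≤ spa w p := by
    intro p hp x hx
    obtain ⟨Δ, hΔ⟩ := hp.exists_spanFeasible hw
    rw [hA] at hx
    rcases hx with (rfl | ⟨j, F, hF, hne, heq, rfl⟩) |
      ⟨j₁, j₂, F₁, hF₁, F₂, hF₂, hlt, hgt, rfl⟩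
    · exact spa_nonneg w p
    · rw [div_le_iff₀ (invw_sdiff_pos hw hne heq)]
      simpa [heq] using hΔ j F hF
    · have h₁ : 0 < invw w Fstar - invw w F₁ := sub_pos.2 hlt
      have h₂ : invw w Fstar - invw w F₂ < 0 := sub_neg.2 hgt
      rw [elimination_le_iff h₁ h₂ (hsdiff_pos F₁ hlt) (invw_nonneg hw _)]
      refine le_trans (b := Δ) ?_ ?_
      · rw [div_le_iff₀ h₁]
        linarith [hΔ j₁ F₁ hF₁]
      · rw [le_div_iff_of_neg h₂]
        linarith [hΔ j₂ F₂ hF₂]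
  have hfeas : ∃ Δ, SpanFeasible 𝓕 Fstar c w m Δ := by
    let bound : Fin k × Finset S → ℝ := fun q =>
      (costSum (c q.1) Fstar - costSum (c q.1) q.2 - m * invw w (Fstar \ q.2)) /
        (invw w Fstar - invw w q.2)
    obtain ⟨Δ, hlow, hupp⟩ := exists_between_of_finite
      ((Set.toFinite {q : Fin k × Finset S | q.2 ∈ 𝓕 ∧ invw w q.2 < invw w Fstar}).image bound)
      ((Set.toFinite {q : Fin k × Finset S | q.2 ∈ 𝓕 ∧ invw w Fstar < invw w q.2}).image bound)
      (by
        rintro _ ⟨⟨j₁, F₁⟩, ⟨hF₁, hlt⟩, rfl⟩ _ ⟨⟨j₂, F₂⟩, ⟨hF₂, hgt⟩, rfl⟩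
        refine (elimination_le_iff (sub_pos.2 hlt) (sub_neg.2 hgt) (hsdiff_pos F₁ hlt)
          (invw_nonneg hw _)).1 (hmax _ ?_)
        rw [hA]
        exact Or.inr ⟨j₁, j₂, F₁, hF₁, F₂, hF₂, hlt, hgt, rfl⟩)
    refine ⟨Δ, fun j F hF => ?_⟩
    rcases lt_trichotomy (invw w F) (invw w Fstar) with hlt | heq | hgt
    · have h := hlow _ ⟨(j, F), ⟨hF, hlt⟩, rfl⟩
      rw [div_le_iff₀ (sub_pos.2 hlt)] at h
      linarith
    · by_cases hne : F = Fstar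
      · simp [hne, invw]
      · have h : (costSum (c j) Fstar - costSum (c j) F) / invw w (Fstar \ F) ≤ m := by
          refine hmax _ ?_
          rw [hA]
          exact Or.inl (Or.inr ⟨j, F, hF, hne, heq, rfl⟩)
        rw [div_le_iff₀ (invw_sdiff_pos hw hne heq)] at h
        simpa [heq] using h
    · have h := hupp _ ⟨(j, F), ⟨hF, hgt⟩, rfl⟩
      rw [le_div_iff_of_neg (sub_neg.2 hgt)] at h
      linarith
  obtain ⟨Δ, hΔ⟩ := hfeas
  obtain ⟨p, hp, hpm⟩ := hΔ.exists_feasibleU hw (hmax 0 h0A)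
  refine ⟨m, ⟨⟨p, hp, hpm.antisymm (hle p hp m hmA)⟩, ?_⟩, hmA, hmax⟩
  rintro x ⟨q, hq, rfl⟩
  exact hle q hq m hmA
end
end
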